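/- arXiv:2511.19566 — 4 statements merged into one kernel-verified Lean document; each statement's English description precedes it below -/
import Mathlib

section
/- Let H be a real inner product space, n a natural number, A : Fin n → H a family of vectors with Y = ∑_i A_i, and let Q be the Gram matrix Q_{ij} = ⟨A_i, A_j⟩. Let C ⊆ Fin n be a subset such that the principal submatrix Q[C,C] is invertible, and let C̄ denote the complement of C. Define δ* : Fin n → ℝ by δ*_i = 1 + ((Q[C,C])⁻¹ · Q[C,C̄] · 1_{C̄})_i for i ∈ C and δ*_i = 0 for i ∉ C, where 1_{C̄} is the all-ones vector indexed by C̄. Then for every δ : Fin n → ℝ with δ_i = 0 for all i ∉ C, ‖Y − ∑_{i ∈ C} δ*_i • A_i‖² ≤ ‖Y − ∑_{i ∈ C} δ_i • A_i‖²; that is, δ* is an optimal compensation term. -/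
open scoped RealInnerProductSpace
open Finset Matrix

noncomputable section

/-- The Gram matrix `Q` of a family `A : Fin n → H`, `Q i j = ⟪A i, A j⟫`. -/
def gramMatrix {H : Type*} [NormedAddCommGroup H] [InnerProductSpace ℝ H]
    {n : ℕ} (A : Fin n → H) : Matrix (Fin n) (Fin n) ℝ :=
  fun i j => ⟪A i, A j⟫

/-- The submatrix `Q[C,D]` of `Q` with rows indexed by `C` and columns by `D`. -/
def gramSub {n : ℕ} (Q : Matrix (Fin n) (Fin n) ℝ) (C D : Finset (Fin n)) :
    Matrix C D ℝ :=
  Q.submatrix (fun i : C => (i : Fin n)) (fun j : D => (j : Fin n))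

/-- The compensation term `δ*` supported on `C`:
`δ*_i = 1 + ((Q[C,C])⁻¹ · Q[C,C̄] · 1_{C̄})_i` for `i ∈ C` and `δ*_i = 0` otherwise. -/
def compOpt {H : Type*} [NormedAddCommGroup H] [InnerProductSpace ℝ H]
    {n : ℕ} (A : Fin n → H) (C : Finset (Fin n)) : Fin n → ℝ :=
  fun i =>
    if h : i ∈ C then
      1 + (((gramSub (gramMatrix A) C C)⁻¹ * gramSub (gramMatrix A) C Cᶜ) *ᵥ
            fun _ : ↥(Cᶜ : Finset (Fin n)) => (1 : ℝ)) ⟨i, h⟩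
    else 0

/-- The residual of `δ*` is orthogonal to every retained vector. -/
lemma inner_residual_compOpt {H : Type*} [NormedAddCommGroup H] [InnerProductSpace ℝ H]
    {n : ℕ} (A : Fin n → H) (C : Finset (Fin n))
    (hinv : IsUnit (gramSub (gramMatrix A) C C)) {k : Fin n} (hk : k ∈ C) :
    ⟪A k, (∑ i, A i) - ∑ i ∈ C, compOpt A C i • A i⟫ = 0 := by
  have hdet := (Matrix.isUnit_iff_isUnit_det _).mp hinv
  set v : C → ℝ := ((gramSub (gramMatrix A) C C)⁻¹ * gramSub (gramMatrix A) C Cᶜ) *ᵥ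
    fun _ : ↥(Cᶜ : Finset (Fin n)) => (1 : ℝ) with hv
  have hnormal : gramSub (gramMatrix A) C C *ᵥ v =
      gramSub (gramMatrix A) C Cᶜ *ᵥ fun _ => (1 : ℝ) := by
    rw [hv, Matrix.mulVec_mulVec, Matrix.mul_nonsing_inv_cancel_left _ _ hdet]
  have hnormal_k : ∑ j : C, ⟪A k, A j⟫ * v j = ∑ j ∈ Cᶜ, ⟪A k, A j⟫ := by
    rw [← Finset.sum_coe_sort Cᶜ]
    simpa [Matrix.mulVec, dotProduct, gramSub, gramMatrix] using congrFun hnormal ⟨k, hk⟩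
  have hcomp : ∑ i ∈ C, compOpt A C i • A i = ∑ i ∈ C, A i + ∑ j : C, v j • A j := by
    rw [← Finset.sum_coe_sort C, ← Finset.sum_coe_sort C, ← Finset.sum_add_distrib]
    refine Finset.sum_congr rfl fun j _ => ?_
    simp [compOpt, hv, add_smul]
  rw [hcomp, ← Finset.sum_add_sum_compl C A, add_sub_add_left_eq_sub, inner_sub_right,
    inner_sum, inner_sum, ← hnormal_k, sub_eq_zero]
  refine Finset.sum_congr rfl fun j _ => ?_
  rw [real_inner_smul_right, mul_comm]

/-- Optimality of the compensation term: for any `δ` supported on `C`, the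
reconstruction error of `δ*` is no larger than that of `δ`. -/
theorem compOpt_optimal {H : Type*} [NormedAddCommGroup H] [InnerProductSpace ℝ H]
    {n : ℕ} (A : Fin n → H) (C : Finset (Fin n))
    (hinv : IsUnit (gramSub (gramMatrix A) C C)) :
    ∀ δ : Fin n → ℝ, (∀ i ∉ C, δ i = 0) →
      ‖(∑ i, A i) - ∑ i ∈ C, compOpt A C i • A i‖ ^ 2 ≤
        ‖(∑ i, A i) - ∑ i ∈ C, δ i • A i‖ ^ 2 := by
  intro δ _
  set r := (∑ i, A i) - ∑ i ∈ C, compOpt A C i • A i with hr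
  have hsplit : (∑ i, A i) - ∑ i ∈ C, δ i • A i =
      r + ∑ i ∈ C, (compOpt A C i - δ i) • A i := by
    simp only [hr, sub_smul, Finset.sum_sub_distrib]
    abel
  have horth : ⟪r, ∑ i ∈ C, (compOpt A C i - δ i) • A i⟫ = 0 := by
    rw [inner_sum]
    refine Finset.sum_eq_zero fun i hi => ?_
    rw [real_inner_smul_right, real_inner_comm, inner_residual_compOpt A C hinv hi, mul_zero]
  rw [hsplit, norm_add_sq_real, horth]
  nlinarith [sq_nonneg ‖∑ i ∈ C, (compOpt A C i - δ i) • A i‖]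

end
end

section
/- Let H be a real inner product space, n a natural number, and A : Fin n → H a family of pairwise orthogonal vectors with Y = ∑_i A_i ≠ 0. Then for every subset S ⊆ Fin n, the Subset Fidelity satisfies FS(S) = (∑_{i ∈ S} ‖A_i‖²) / (∑_{j} ‖A_j‖²). In particular, the singleton fidelity of component i equals ‖A_i‖² / ∑_j ‖A_j‖². -/
open scoped RealInnerProductSpace
open Finset

/-- The Subset Fidelity of a subset `C` of components `A : Fin n → H`:
`FS(C) = 1 − (⨅ over δ supported on C of ‖Y − ∑_{i ∈ C} δ i • A i‖²) / ‖Y‖²`,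
where `Y = ∑ i, A i`. -/
noncomputable def subsetFidelity {H : Type*} [NormedAddCommGroup H] [InnerProductSpace ℝ H]
    {n : ℕ} (A : Fin n → H) (C : Finset (Fin n)) : ℝ :=
  1 - (⨅ δ : {δ : Fin n → ℝ // ∀ i ∉ C, δ i = 0},
        ‖(∑ i, A i) - ∑ i ∈ C, (δ : Fin n → ℝ) i • A i‖ ^ 2) / ‖∑ i, A i‖ ^ 2

/-- The Pythagorean identity for a linear combination of pairwise orthogonal vectors. -/
theorem norm_sq_sum_smul_of_orthogonal {ι H : Type*} [NormedAddCommGroup H]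
    [InnerProductSpace ℝ H] {A : ι → H} (horth : ∀ i j, i ≠ j → ⟪A i, A j⟫ = 0)
    (s : Finset ι) (c : ι → ℝ) :
    ‖∑ i ∈ s, c i • A i‖ ^ 2 = ∑ i ∈ s, c i ^ 2 * ‖A i‖ ^ 2 := by
  rw [← real_inner_self_eq_norm_sq, sum_inner]
  refine Finset.sum_congr rfl fun i hi => ?_
  rw [inner_sum, Finset.sum_eq_single_of_mem i hi fun j _ hji => by
    rw [real_inner_smul_left, real_inner_smul_right, horth i j hji.symm, mul_zero, mul_zero],
    real_inner_self_eq_norm_sq, norm_smul, mul_pow, Real.norm_eq_abs, sq_abs]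

/-- For a pairwise orthogonal family, the least squared error of approximating the total by
combinations of the components in `S` is the energy of the components outside `S`. -/
theorem iInf_norm_sq_sum_sub_of_orthogonal {ι H : Type*} [Fintype ι] [DecidableEq ι]
    [NormedAddCommGroup H] [InnerProductSpace ℝ H] {A : ι → H}
    (horth : ∀ i j, i ≠ j → ⟪A i, A j⟫ = 0) (S : Finset ι) :
    (⨅ δ : {δ : ι → ℝ // ∀ i ∉ S, δ i = 0},
      ‖(∑ i, A i) - ∑ i ∈ S, (δ : ι → ℝ) i • A i‖ ^ 2) = ∑ i ∈ Sᶜ, ‖A i‖ ^ 2 := by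
  have key (δ : {δ : ι → ℝ // ∀ i ∉ S, δ i = 0}) :
      ‖(∑ i, A i) - ∑ i ∈ S, (δ : ι → ℝ) i • A i‖ ^ 2 =
        ∑ i ∈ S, (1 - (δ : ι → ℝ) i) ^ 2 * ‖A i‖ ^ 2 + ∑ i ∈ Sᶜ, ‖A i‖ ^ 2 := by
    have hsub : (∑ i, A i) - ∑ i ∈ S, (δ : ι → ℝ) i • A i =
        ∑ i, (1 - (δ : ι → ℝ) i) • A i := by
      rw [Finset.sum_subset S.subset_univ fun i _ hi => by rw [δ.2 i hi, zero_smul],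
        ← Finset.sum_sub_distrib]
      simp only [sub_smul, one_smul]
    rw [hsub, norm_sq_sum_smul_of_orthogonal horth, ← Finset.sum_add_sum_compl S]
    congr 1
    refine Finset.sum_congr rfl fun i hi => ?_
    rw [δ.2 i (Finset.mem_compl.mp hi), sub_zero, one_pow, one_mul]
  refine IsLeast.csInf_eq ⟨⟨⟨fun i => if i ∈ S then 1 else 0, fun i hi => if_neg hi⟩, ?_⟩, ?_⟩
  · refine (key _).trans ?_
    rw [add_eq_right]
    exact Finset.sum_eq_zero fun i hi => by simp [hi]
  · rintro _ ⟨δ, rfl⟩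
    exact (le_add_of_nonneg_left (Finset.sum_nonneg fun i _ => by positivity)).trans_eq (key δ).symm

/-- For a pairwise orthogonal family, the Subset Fidelity of any subset `S` is
`(∑_{i ∈ S} ‖A i‖²) / (∑_j ‖A j‖²)`; in particular the singleton fidelity of `i`
is `‖A i‖² / ∑_j ‖A j‖²`. -/
theorem subsetFidelity_orthogonal {H : Type*} [NormedAddCommGroup H]
    [InnerProductSpace ℝ H] {n : ℕ} (A : Fin n → H)
    (horth : ∀ i j, i ≠ j → ⟪A i, A j⟫ = 0) (hY : (∑ i, A i) ≠ 0) :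
    (∀ S : Finset (Fin n),
      subsetFidelity A S = (∑ i ∈ S, ‖A i‖ ^ 2) / ∑ j, ‖A j‖ ^ 2) ∧
    (∀ i : Fin n, subsetFidelity A {i} = ‖A i‖ ^ 2 / ∑ j, ‖A j‖ ^ 2) := by
  have hnorm : ‖∑ i, A i‖ ^ 2 = ∑ i, ‖A i‖ ^ 2 := by
    simpa using norm_sq_sum_smul_of_orthogonal horth univ fun _ => 1
  have hpos : (∑ i, ‖A i‖ ^ 2) ≠ 0 := hnorm ▸ pow_ne_zero 2 (norm_ne_zero_iff.mpr hY)
  have main (S : Finset (Fin n)) :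
      subsetFidelity A S = (∑ i ∈ S, ‖A i‖ ^ 2) / ∑ j, ‖A j‖ ^ 2 := by
    rw [subsetFidelity, iInf_norm_sq_sum_sub_of_orthogonal horth, hnorm, one_sub_div hpos,
      ← Finset.sum_add_sum_compl S, add_sub_cancel_right]
  exact ⟨main, fun i => by rw [main, Finset.sum_singleton]⟩
end

section
/- Fix d ≥ 1, let γ, β ∈ EuclideanSpace ℝ (Fin d), let M : EuclideanSpace ℝ (Fin d) →L[ℝ] EuclideanSpace ℝ (Fin d) be a continuous linear map, and let r > 0. Define Norm(x) = γ ⊙ (M x / ‖M x‖) + β, where ⊙ is the coordinatewise (Hadamard) product. Then on the set {x : ‖M x‖ ≥ r}, Norm is Lipschitz continuous with constant (max_i |γ_i|) · ‖M‖ / r, where ‖M‖ is the operator norm of M; that is, for all x, y with ‖Mx‖ ≥ r and ‖My‖ ≥ r, ‖Norm(x) − Norm(y)‖ ≤ ((max_i |γ_i|)·‖M‖/r)·‖x − y‖. -/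
noncomputable section

/-- The normalization layer `Norm(x) = γ ⊙ (M x / ‖M x‖) + β` (covering RMSNorm and
LayerNorm), where `⊙` is the coordinatewise (Hadamard) product. -/
def normLayer {d : ℕ} (γ β : EuclideanSpace ℝ (Fin d))
    (M : EuclideanSpace ℝ (Fin d) →L[ℝ] EuclideanSpace ℝ (Fin d))
    (x : EuclideanSpace ℝ (Fin d)) : EuclideanSpace ℝ (Fin d) :=
  (WithLp.equiv 2 (Fin d → ℝ)).symm (fun i => γ i * ((‖M x‖⁻¹ • M x) i) + β i)

/-- Radial projection to the unit sphere is `r⁻¹`-Lipschitz outside the open ball of radius `r`. -/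
theorem norm_inv_norm_smul_sub_le {E : Type*} [NormedAddCommGroup E] [InnerProductSpace ℝ E]
    {r : ℝ} (hr : 0 < r) {u v : E} (hu : r ≤ ‖u‖) (hv : r ≤ ‖v‖) :
    ‖‖u‖⁻¹ • u - ‖v‖⁻¹ • v‖ ≤ ‖u - v‖ / r := by
  have ha : 0 < ‖u‖ := hr.trans_le hu
  have hb : 0 < ‖v‖ := hr.trans_le hv
  set c := inner ℝ u v / (‖u‖ * ‖v‖) with hc
  have hc1 : c ≤ 1 := div_le_one_of_le₀ (real_inner_le_norm u v) (by positivity)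
  have hin : inner ℝ u v = ‖u‖ * ‖v‖ * c := by rw [hc]; field_simp
  have hunit : ‖‖u‖⁻¹ • u - ‖v‖⁻¹ • v‖ ^ 2 = 2 - 2 * c := by
    rw [norm_sub_sq_real, real_inner_smul_left, real_inner_smul_right, hin, norm_smul, norm_smul,
      norm_inv, norm_inv, norm_norm, norm_norm]
    field_simp
    ring
  have hdiff : ‖u - v‖ ^ 2 = ‖u‖ ^ 2 - 2 * (‖u‖ * ‖v‖ * c) + ‖v‖ ^ 2 := by
    rw [norm_sub_sq_real, hin]
  rw [le_div_iff₀ hr]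
  refine (sq_le_sq₀ (by positivity) (by positivity)).1 ?_
  rw [mul_pow, hunit, hdiff]
  have hprod : r * r ≤ ‖u‖ * ‖v‖ := mul_le_mul hu hv hr.le ha.le
  nlinarith [sq_nonneg (‖u‖ - ‖v‖), mul_nonneg (sub_nonneg.2 hprod) (sub_nonneg.2 hc1)]

/-- Coordinatewise multiplication by `γ` scales the Euclidean norm by at most `⨆ i, |γ i|`. -/
theorem norm_toLp_mul_le {ι : Type*} [Fintype ι] (γ w : EuclideanSpace ℝ ι) :
    ‖WithLp.toLp 2 (fun i => γ i * w i)‖ ≤ (⨆ i, |γ i|) * ‖w‖ := by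
  have hG : 0 ≤ ⨆ i, |γ i| := Real.iSup_nonneg fun i => abs_nonneg _
  refine (sq_le_sq₀ (by positivity) (by positivity)).1 ?_
  rw [mul_pow, EuclideanSpace.real_norm_sq_eq, EuclideanSpace.real_norm_sq_eq, Finset.mul_sum]
  refine Finset.sum_le_sum fun i _ => ?_
  rw [mul_pow, ← sq_abs (γ i)]
  gcongr
  exact le_ciSup (f := fun i => |γ i|) (Set.finite_range _).bddAbove i

/-- On the region where `‖M x‖ ≥ r > 0`, the normalization layer is Lipschitz with
constant `(max_i |γ_i|) · ‖M‖ / r`. -/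
theorem normLayer_lipschitz {d : ℕ} (hd : 1 ≤ d) (γ β : EuclideanSpace ℝ (Fin d))
    (M : EuclideanSpace ℝ (Fin d) →L[ℝ] EuclideanSpace ℝ (Fin d)) {r : ℝ} (hr : 0 < r) :
    ∀ x y : EuclideanSpace ℝ (Fin d), r ≤ ‖M x‖ → r ≤ ‖M y‖ →
      ‖normLayer γ β M x - normLayer γ β M y‖ ≤
        ((⨆ i : Fin d, |γ i|) * ‖M‖ / r) * ‖x - y‖ := by
  intro x y hx hy
  have hG : 0 ≤ ⨆ i, |γ i| := Real.iSup_nonneg fun i => abs_nonneg _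
  have hsub : normLayer γ β M x - normLayer γ β M y =
      WithLp.toLp 2 (fun i => γ i * (‖M x‖⁻¹ • M x - ‖M y‖⁻¹ • M y) i) := by
    ext i
    simp [normLayer]
    ring
  calc ‖normLayer γ β M x - normLayer γ β M y‖
      ≤ (⨆ i, |γ i|) * ‖‖M x‖⁻¹ • M x - ‖M y‖⁻¹ • M y‖ := hsub ▸ norm_toLp_mul_le γ _
    _ ≤ (⨆ i, |γ i|) * (‖M x - M y‖ / r) := by
      gcongr
      exact norm_inv_norm_smul_sub_le hr hx hy
    _ ≤ (⨆ i, |γ i|) * (‖M‖ * ‖x - y‖ / r) := by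
      gcongr
      rw [← map_sub]
      exact M.le_opNorm _
    _ = ((⨆ i, |γ i|) * ‖M‖ / r) * ‖x - y‖ := by ring

end
end

section
/- Let H be a real inner product space, n a natural number, and A : Fin n → H a family of pairwise orthogonal vectors with Y = ∑_i A_i ≠ 0. Fix k ≤ n. Then the maximum of FS(S) over all subsets S ⊆ Fin n of cardinality k equals (the sum of the k largest values among ‖A_1‖², …, ‖A_n‖²) divided by ∑_j ‖A_j‖². -/
open scoped RealInnerProductSpace
open Finset

theorem norm_sq_sum_smul_of_pairwise_orthogonal {ι H : Type*} [Fintype ι]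
    [NormedAddCommGroup H] [InnerProductSpace ℝ H] (A : ι → H)
    (horth : ∀ i j, i ≠ j → ⟪A i, A j⟫ = 0) (c : ι → ℝ) :
    ‖∑ i, c i • A i‖ ^ 2 = ∑ i, c i ^ 2 * ‖A i‖ ^ 2 := by
  rw [← real_inner_self_eq_norm_sq, sum_inner]
  refine Finset.sum_congr rfl fun i _ => ?_
  rw [inner_sum, Finset.sum_eq_single i]
  · rw [real_inner_smul_left, real_inner_smul_right, real_inner_self_eq_norm_sq]
    ring
  · intro j _ hj
    rw [real_inner_smul_left, real_inner_smul_right, horth i j hj.symm]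
    simp
  · simp

theorem norm_sq_sum_of_pairwise_orthogonal {ι H : Type*} [Fintype ι]
    [NormedAddCommGroup H] [InnerProductSpace ℝ H] (A : ι → H)
    (horth : ∀ i j, i ≠ j → ⟪A i, A j⟫ = 0) :
    ‖∑ i, A i‖ ^ 2 = ∑ i, ‖A i‖ ^ 2 := by
  simpa using norm_sq_sum_smul_of_pairwise_orthogonal A horth 1

/-- For an orthogonal family, the residual left by the coefficients `δ` on `C` splits into the
part inside `C` and the unavoidable part outside `C`. -/
theorem norm_sq_sum_sub_sum_smul_of_pairwise_orthogonal {ι H : Type*} [Fintype ι] [DecidableEq ι]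
    [NormedAddCommGroup H] [InnerProductSpace ℝ H] (A : ι → H)
    (horth : ∀ i j, i ≠ j → ⟪A i, A j⟫ = 0) (C : Finset ι) (δ : ι → ℝ) :
    ‖(∑ i, A i) - ∑ i ∈ C, δ i • A i‖ ^ 2 =
      ∑ i ∈ C, (1 - δ i) ^ 2 * ‖A i‖ ^ 2 + ∑ i ∈ Cᶜ, ‖A i‖ ^ 2 := by
  have h : (∑ i, A i) - ∑ i ∈ C, δ i • A i = ∑ i, (if i ∈ C then 1 - δ i else 1) • A i := by
    rw [← Finset.sum_add_sum_compl C A, ← Finset.sum_add_sum_compl C fun i => (_ : ℝ) • A i,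
      add_sub_right_comm, ← Finset.sum_sub_distrib]
    congr 1
    · exact Finset.sum_congr rfl fun i hi => by simp [hi, sub_smul]
    · exact Finset.sum_congr rfl fun i hi => by simp [Finset.mem_compl.mp hi]
  rw [h, norm_sq_sum_smul_of_pairwise_orthogonal A horth, ← Finset.sum_add_sum_compl C]
  congr 1
  · exact Finset.sum_congr rfl fun i hi => by simp [hi]
  · exact Finset.sum_congr rfl fun i hi => by simp [Finset.mem_compl.mp hi]

theorem subsetFidelity_eq_of_pairwise_orthogonal {H : Type*} [NormedAddCommGroup H]
    [InnerProductSpace ℝ H] {n : ℕ} (A : Fin n → H)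
    (horth : ∀ i j, i ≠ j → ⟪A i, A j⟫ = 0) (hY : (∑ i, A i) ≠ 0) (C : Finset (Fin n)) :
    subsetFidelity A C = (∑ i ∈ C, ‖A i‖ ^ 2) / ∑ j, ‖A j‖ ^ 2 := by
  have hpos : ‖∑ i, A i‖ ^ 2 ≠ 0 := by simpa using hY
  have hinf : (⨅ δ : {δ : Fin n → ℝ // ∀ i ∉ C, δ i = 0},
      ‖(∑ i, A i) - ∑ i ∈ C, (δ : Fin n → ℝ) i • A i‖ ^ 2) = ∑ i ∈ Cᶜ, ‖A i‖ ^ 2 := by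
    refine IsLeast.csInf_eq ⟨⟨⟨fun i => if i ∈ C then 1 else 0, fun i hi => if_neg hi⟩, ?_⟩, ?_⟩
    · dsimp only
      rw [norm_sq_sum_sub_sum_smul_of_pairwise_orthogonal A horth, add_eq_right]
      exact Finset.sum_eq_zero fun i hi => by simp [hi]
    · rintro _ ⟨δ, rfl⟩
      dsimp only
      rw [norm_sq_sum_sub_sum_smul_of_pairwise_orthogonal A horth]
      exact le_add_of_nonneg_left (Finset.sum_nonneg fun i _ => by positivity)
  rw [subsetFidelity, hinf]
  rw [norm_sq_sum_of_pairwise_orthogonal A horth] at hpos ⊢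
  rw [eq_div_iff hpos, sub_mul, div_mul_cancel₀ _ hpos, one_mul,
    ← Finset.sum_add_sum_compl C, add_sub_cancel_right]

theorem Fin.val_le_val_of_strictMono {k n : ℕ} {f : Fin k → Fin n} (hf : StrictMono f)
    (i : Fin k) : (i : ℕ) ≤ f i := by
  obtain ⟨m, hm⟩ := i
  induction m with
  | zero => exact Nat.zero_le _
  | succ m ih =>
    exact (ih (Nat.lt_of_succ_lt hm)).trans_lt (hf (Fin.mk_lt_mk.mpr m.lt_succ_self))

theorem Antitone.sum_le_sum_castLE {M : Type*} [AddCommMonoid M] [PartialOrder M]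
    [IsOrderedAddMonoid M] {n k : ℕ} {g : Fin n → M} (hg : Antitone g) (hk : k ≤ n)
    {T : Finset (Fin n)} (hT : T.card = k) :
    ∑ i ∈ T, g i ≤ ∑ i : Fin k, g (Fin.castLE hk i) := by
  conv_lhs => rw [← Finset.map_orderEmbOfFin_univ T hT, Finset.sum_map]
  exact Finset.sum_le_sum fun i _ =>
    hg (Fin.val_le_val_of_strictMono (T.orderEmbOfFin hT).strictMono i)

/-- For a pairwise orthogonal family, the maximum of `FS(S)` over subsets of
cardinality `k` equals the sum of the `k` largest values among `‖A_1‖², …, ‖A_n‖²`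
divided by `∑_j ‖A j‖²`.  The `k` largest values are expressed via any permutation
`e` arranging the scores `‖A (e i)‖²` in decreasing order. -/
theorem maxFidelity_eq_topk_ratio {H : Type*} [NormedAddCommGroup H]
    [InnerProductSpace ℝ H] {n : ℕ} (A : Fin n → H)
    (horth : ∀ i j, i ≠ j → ⟪A i, A j⟫ = 0) (hY : (∑ i, A i) ≠ 0)
    (k : ℕ) (hk : k ≤ n)
    (e : Equiv.Perm (Fin n)) (hsort : Antitone fun i => ‖A (e i)‖ ^ 2) :
    IsGreatest {x : ℝ | ∃ S : Finset (Fin n), S.card = k ∧ x = subsetFidelity A S}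
      ((∑ i : Fin k, ‖A (e (Fin.castLE hk i))‖ ^ 2) / ∑ j, ‖A j‖ ^ 2) := by
  constructor
  · refine ⟨Finset.univ.map ((Fin.castLEEmb hk).trans e.toEmbedding), by simp, ?_⟩
    rw [subsetFidelity_eq_of_pairwise_orthogonal A horth hY, Finset.sum_map]
    rfl
  · rintro _ ⟨S, hS, rfl⟩
    rw [subsetFidelity_eq_of_pairwise_orthogonal A horth hY]
    gcongr
    have h := hsort.sum_le_sum_castLE hk (T := S.map e.symm.toEmbedding) (by simpa using hS)
    simpa using h
end
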